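/- Let V ⊆ T*X be a closed conic subset such that V ∩ Ṫ*_M X = ∅, i.e. V contains no point of the form (x⁽⁰⁾,0,…,0; 0,ξ⁽¹⁾,…,ξ⁽ˡ⁾) with (ξ⁽¹⁾,…,ξ⁽ˡ⁾) ≠ 0. Then C_{χ*}(V) ∩ Ṡ*_χ = ∅: there is no point (x⁽⁰⁾; ξ⁽¹⁾,…,ξ⁽ˡ⁾) with (ξ⁽¹⁾,…,ξ⁽ˡ⁾) ≠ 0 for which there exist a sequence {(x⁽⁰⁾_n,…,x⁽ˡ⁾_n; ξ⁽⁰⁾_n,…,ξ⁽ˡ⁾_n)} ⊆ V and a sequence {(c⁽¹⁾_n,…,c⁽ˡ⁾_n)} ⊆ (0,∞)^ℓ with c⁽ʲ⁾_n → ∞ for every j = 1,…,ℓ, such that (x⁽⁰⁾_n, c⁽Ĵ₁⁾_n x⁽¹⁾_n, …, c⁽Ĵ_ℓ⁾_n x⁽ˡ⁾_n; c_n ξ⁽⁰⁾_n, c⁽Ĵ₁⁾_n ξ⁽¹⁾_n, …, c⁽Ĵ_ℓ⁾_n ξ⁽ˡ⁾_n) → (x⁽⁰⁾, 0,…,0;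 0, ξ⁽¹⁾,…,ξ⁽ˡ⁾) as n → ∞. -/

import Mathlib

open Filter Topology

/-- `c⁽Ĵⱼ⁾ = ∏_{k ≠ j} c k`, the product of the scaling parameters over the
complement `Ĵⱼ = {1,…,ℓ} \ {j}`. -/
def cJhat {ℓ : ℕ} (c : Fin ℓ → ℝ) (j : Fin ℓ) : ℝ :=
  ∏ k ∈ Finset.univ.erase j, c k

/-- `c = c⁽¹⁾ ⋯ c⁽ˡ⁾`, the product of all the scaling parameters. -/
def ctot {ℓ : ℕ} (c : Fin ℓ → ℝ) : ℝ :=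
  ∏ k, c k

theorem ctot_eq_mul_cJhat {ℓ : ℕ} (c : Fin ℓ → ℝ) (j : Fin ℓ) :
    ctot c = c j * cJhat c j :=
  (Finset.mul_prod_erase Finset.univ c (Finset.mem_univ j)).symm

theorem one_le_cJhat {ℓ : ℕ} {c : Fin ℓ → ℝ} (hc : ∀ k, 1 ≤ c k) (j : Fin ℓ) :
    1 ≤ cJhat c j :=
  Finset.prod_induction c (1 ≤ ·) (fun _ _ => one_le_mul_of_one_le_of_one_le) le_rfl fun k _ => hc k

/-- If `a m • v m → 0` with `a m ≥ 1` eventually, then `v m → 0`. -/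
theorem tendsto_zero_of_one_le_smul {E : Type*} [NormedAddCommGroup E] [NormedSpace ℝ E]
    {a : ℕ → ℝ} {v : ℕ → E} (ha : ∀ᶠ m in atTop, 1 ≤ a m)
    (h : Tendsto (fun m => a m • v m) atTop (𝓝 0)) : Tendsto v atTop (𝓝 0) := by
  refine squeeze_zero_norm' ?_ (tendsto_zero_iff_norm_tendsto_zero.mp h)
  filter_upwards [ha] with m hm
  rw [norm_smul, Real.norm_of_nonneg (zero_le_one.trans hm)]
  exact le_mul_of_one_le_left (norm_nonneg _) hm

/-- Work on `X = ℝ^{n₀} × ⋯ × ℝ^{n_ℓ}`, `T*X = X × X`, with the normal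
crossing family `M_j = {x⁽ʲ⁾ = 0}`.  If `V ⊆ T*X` is a closed conic subset with
`V ∩ Ṫ*_M X = ∅`, then `C_{χ*}(V) ∩ Ṡ*_χ = ∅`: there is no point
`(x⁽⁰⁾; ξ⁽¹⁾,…,ξ⁽ˡ⁾)` with `(ξ⁽¹⁾,…,ξ⁽ˡ⁾) ≠ 0` admitting a sequence in `V` and
scalings `c⁽ʲ⁾_n → ∞` with
`(x⁽⁰⁾_n, c⁽Ĵ₁⁾_n x⁽¹⁾_n, …, c⁽Ĵ_ℓ⁾_n x⁽ˡ⁾_n; c_n ξ⁽⁰⁾_n, c⁽Ĵ₁⁾_n ξ⁽¹⁾_n, …, c⁽Ĵ_ℓ⁾_n ξ⁽ˡ⁾_n)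
→ (x⁽⁰⁾, 0,…,0; 0, ξ⁽¹⁾,…,ξ⁽ˡ⁾)`. -/
theorem stmt0 (ℓ : ℕ) (hℓ : 1 ≤ ℓ) (n : Fin (ℓ + 1) → ℕ)
    (V : Set ((∀ j, (Fin (n j) → ℝ)) × (∀ j, (Fin (n j) → ℝ))))
    (hVclosed : IsClosed V)
    (hVconic : ∀ p ∈ V, ∀ t : ℝ, 0 < t → (p.1, t • p.2) ∈ V)
    (hVM : ∀ (x0 : Fin (n 0) → ℝ) (η : ∀ j : Fin ℓ, Fin (n j.succ) → ℝ),
      η ≠ 0 →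
      ((Fin.cases (motive := fun j => Fin (n j) → ℝ) x0 (fun _ => 0)),
       (Fin.cases (motive := fun j => Fin (n j) → ℝ) 0 η)) ∉ V) :
    ¬ ∃ (x0 : Fin (n 0) → ℝ) (η : ∀ j : Fin ℓ, Fin (n j.succ) → ℝ),
        η ≠ 0 ∧
        ∃ (p : ℕ → (∀ j, (Fin (n j) → ℝ)) × (∀ j, (Fin (n j) → ℝ)))
          (c : ℕ → Fin ℓ → ℝ),
          (∀ m, p m ∈ V) ∧
          (∀ m j, 0 < c m j) ∧
          (∀ j, Tendsto (fun m => c m j) atTop atTop) ∧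
          Tendsto (fun m =>
              ((Fin.cases (motive := fun j => Fin (n j) → ℝ)
                  ((p m).1 0) (fun j => cJhat (c m) j • (p m).1 j.succ)),
               (Fin.cases (motive := fun j => Fin (n j) → ℝ)
                  (ctot (c m) • (p m).2 0) (fun j => cJhat (c m) j • (p m).2 j.succ))))
            atTop
            (𝓝 ((Fin.cases (motive := fun j => Fin (n j) → ℝ) x0 (fun _ => 0)),
                 (Fin.cases (motive := fun j => Fin (n j) → ℝ) 0 η))) := by
  rintro ⟨x0, η, hη, p, c, hpV, hcpos, hc, hlim⟩
  rw [Prod.tendsto_iff, tendsto_pi_nhds, tendsto_pi_nhds] at hlim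
  obtain ⟨hx, hξ⟩ := hlim
  have hx0 : Tendsto (fun m => (p m).1 0) atTop (𝓝 x0) := hx 0
  have hxs (j : Fin ℓ) : Tendsto (fun m => cJhat (c m) j • (p m).1 j.succ) atTop (𝓝 0) :=
    hx j.succ
  have hξ0 : Tendsto (fun m => ctot (c m) • (p m).2 0) atTop (𝓝 0) := hξ 0
  have hξs (j : Fin ℓ) : Tendsto (fun m => cJhat (c m) j • (p m).2 j.succ) atTop (𝓝 (η j)) :=
    hξ j.succ
  have hc1 : ∀ᶠ m in atTop, ∀ k, 1 ≤ c m k :=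
    eventually_all.mpr fun k => (hc k).eventually_ge_atTop 1
  have hxs' (j : Fin ℓ) : Tendsto (fun m => (p m).1 j.succ) atTop (𝓝 0) :=
    tendsto_zero_of_one_le_smul (hc1.mono fun m hm => one_le_cJhat hm j) (hxs j)
  obtain ⟨j₀, hj₀⟩ := Function.ne_iff.mp hη
  let ζ : ℕ → ∀ j : Fin ℓ, Fin (n j.succ) → ℝ := fun m j => (p m).2 j.succ
  have hctot : ∀ m, 0 < ctot (c m) := fun m => Finset.prod_pos fun k _ => hcpos m k
  have hbig : Tendsto (fun m => ctot (c m) * ‖ζ m‖) atTop atTop := by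
    refine tendsto_atTop_mono (fun m => ?_)
      ((hc j₀).atTop_mul_pos (norm_pos_iff.mpr hj₀) (hξs j₀).norm)
    have hJ : 0 ≤ cJhat (c m) j₀ := Finset.prod_nonneg fun k _ => (hcpos m k).le
    rw [norm_smul, Real.norm_of_nonneg hJ, ← mul_assoc, ← ctot_eq_mul_cJhat]
    exact mul_le_mul_of_nonneg_left (norm_le_pi_norm (ζ m) j₀) (hctot m).le
  have hζpos : ∀ᶠ m in atTop, 0 < ‖ζ m‖ :=
    (hbig.eventually_gt_atTop 0).mono fun m hm => pos_of_mul_pos_right hm (hctot m).le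
  have hscaled : Tendsto (fun m => ‖ζ m‖⁻¹ • (p m).2 0) atTop (𝓝 0) := by
    have h := (tendsto_inv_atTop_zero.comp hbig).smul hξ0
    rw [smul_zero] at h
    refine h.congr fun m => ?_
    simp only [Function.comp_apply, smul_smul]
    congr 1
    have := (hctot m).ne'
    rw [mul_inv, mul_right_comm, inv_mul_cancel₀ this, one_mul]
  have hsphere : ∀ᶠ m in atTop, ‖ζ m‖⁻¹ • ζ m ∈
      Metric.sphere (0 : ∀ j : Fin ℓ, Fin (n j.succ) → ℝ) 1 := by
    filter_upwards [hζpos] with m hm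
    rw [mem_sphere_zero_iff_norm, norm_smul, norm_inv, norm_norm, inv_mul_cancel₀ hm.ne']
  obtain ⟨η', hη', φ, hφ, hφlim⟩ :=
    (isCompact_sphere (0 : ∀ j : Fin ℓ, Fin (n j.succ) → ℝ) 1).tendsto_subseq' hsphere.frequently
  have hη'0 : η' ≠ 0 := ne_zero_of_mem_unit_sphere ⟨η', hη'⟩
  refine hVM x0 η' hη'0 (hVclosed.mem_of_tendsto
    (f := fun m => ((p (φ m)).1, ‖ζ (φ m)‖⁻¹ • (p (φ m)).2)) (b := atTop) ?_ ?_)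
  · rw [Prod.tendsto_iff, tendsto_pi_nhds, tendsto_pi_nhds]
    refine ⟨fun j => ?_, fun j => ?_⟩
    · cases j using Fin.cases with
      | zero => exact hx0.comp hφ.tendsto_atTop
      | succ j => exact (hxs' j).comp hφ.tendsto_atTop
    · cases j using Fin.cases with
      | zero => exact hscaled.comp hφ.tendsto_atTop
      | succ j => exact tendsto_pi_nhds.mp hφlim j
  · filter_upwards [hφ.tendsto_atTop.eventually hζpos] with m hm
    exact hVconic _ (hpV _) _ (inv_pos.mpr hm)
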